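/- For all integers k > d ≥ 1 with k − d > 1, there is no k to d cubical cut and project set which is LR with respect to the collection ℛ_d of aligned rectangles in ℝ^d with integer vertices. -/

import Mathlib

noncomputable section

open MeasureTheory Set Filter

/-- The distance from a real number to the nearest integer. -/
def distInt (x : ℝ) : ℝ := |x - round x|

/-- The real vector in `ℝ^k` corresponding to an integer vector. -/
def intVec {k : ℕ} (n : Fin k → ℤ) : Fin k → ℝ := fun i => (n i : ℝ)

/-- The embedding of `ℝ^d` into `ℝ^k` as the span of the first `d` coordinates. -/
def emb (k d : ℕ) (x : Fin d → ℝ) : Fin k → ℝ :=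
  fun i => if h : (i : ℕ) < d then x ⟨i, h⟩ else 0

/-- A `k` to `d` cut and project scheme: a totally irrational `d`-dimensional subspace
`E ⊆ ℝ^k`, the projection `proj = π` onto `E` along a complementary subspace `F_π`
(injective on `ℤ^k`), the projection `rho = ρ` onto `E` with respect to the decomposition
`ℝ^k = E + F_ρ` where `F_ρ = {0} × ℝ^{k-d}`, a window `W ⊆ F_ρ`, and a point `s`
(a representative of a point of `ℝ^k/ℤ^k`). -/
structure CPS (k d : ℕ) where
  E : Submodule ℝ (Fin k → ℝ)
  rank_E : Module.finrank ℝ E = d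
  /-- `E` is totally irrational: its image in `ℝ^k/ℤ^k` is dense,
  equivalently `E + ℤ^k` is dense in `ℝ^k`. -/
  totallyIrrational : Dense {x : Fin k → ℝ | ∃ e ∈ E, ∃ n : Fin k → ℤ, x = e + intVec n}
  /-- `π`, the projection onto `E` along a complementary subspace `F_π = ker proj`. -/
  proj : (Fin k → ℝ) →ₗ[ℝ] (Fin k → ℝ)
  proj_mem : ∀ x, proj x ∈ E
  proj_id : ∀ x ∈ E, proj x = x
  /-- `π` is injective on `ℤ^k`. -/
  proj_inj : ∀ m n : Fin k → ℤ, proj (intVec m) = proj (intVec n) → m = n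
  /-- `ρ`, the projection onto `E` with respect to the decomposition `ℝ^k = E + F_ρ`. -/
  rho : (Fin k → ℝ) →ₗ[ℝ] (Fin k → ℝ)
  rho_mem : ∀ x, rho x ∈ E
  /-- `x - ρ(x) ∈ F_ρ = {0} × ℝ^{k-d}`; in particular `ρ* = id - ρ` maps into `F_ρ`. -/
  rho_decomp : ∀ (x : Fin k → ℝ) (i : Fin k), (i : ℕ) < d → x i - rho x i = 0
  /-- The window `W ⊆ F_ρ`. -/
  window : Set (Fin k → ℝ)
  window_sub : ∀ x ∈ window, ∀ i : Fin k, (i : ℕ) < d → x i = 0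
  /-- A representative of the point `s ∈ ℝ^k/ℤ^k`. -/
  s : Fin k → ℝ

namespace CPS

variable {k d : ℕ} (𝒟 : CPS k d)

/-- `ρ* : ℝ^k → F_ρ`, the projection onto `F_ρ` along `E`. -/
def rhoStar (x : Fin k → ℝ) : Fin k → ℝ := x - 𝒟.rho x

/-- The strip `S = W + E`. -/
def strip : Set (Fin k → ℝ) := {z | ∃ w ∈ 𝒟.window, ∃ e ∈ (𝒟.E : Set (Fin k → ℝ)), z = w + e}

/-- The cut and project set `Y = π(S ∩ (ℤ^k + s))`. -/
def Y : Set (Fin k → ℝ) :=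
  𝒟.proj '' (𝒟.strip ∩ {z | ∃ n : Fin k → ℤ, z = intVec n + 𝒟.s})

/-- `s` is regular: `ℤ^k + s` does not meet the boundary of the strip. -/
def Regular : Prop := ∀ n : Fin k → ℤ, intVec n + 𝒟.s ∉ frontier 𝒟.strip

/-- `Y` is aperiodic: its group of periods is trivial. -/
def Aperiodic : Prop := ∀ x ∈ (𝒟.E : Set (Fin k → ℝ)),
  {z | ∃ y ∈ 𝒟.Y, z = y + x} = 𝒟.Y → x = 0

/-- The window is the cubical window `{Σ_{i=d+1}^k t_i e_i : 0 ≤ t_i < 1}`. -/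
def IsCubical : Prop :=
  𝒟.window = {x : Fin k → ℝ | ∀ i : Fin k,
    if (i : ℕ) < d then x i = 0 else 0 ≤ x i ∧ x i < 1}

/-- The window is the canonical window `ρ*([0,1]^k)`. -/
def IsCanonical : Prop :=
  𝒟.window = 𝒟.rhoStar '' {x : Fin k → ℝ | ∀ i, x i ∈ Icc (0 : ℝ) 1}

/-- `Y` is a cubical cut and project set: totally irrational (a field of `CPS`),
regular, aperiodic, and formed with the cubical window. -/
def IsCubicalCPSet : Prop := 𝒟.IsCubical ∧ 𝒟.Regular ∧ 𝒟.Aperiodic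

/-- `Y` is a canonical cut and project set. -/
def IsCanonicalCPSet : Prop := 𝒟.IsCanonical ∧ 𝒟.Regular ∧ 𝒟.Aperiodic

/-- For `y ∈ Y`, the (unique, by injectivity of `π` on `ℤ^k`) integer vector `ỹ`
with `ỹ + s ∈ S` and `π(ỹ + s) = y`. -/
def intRep (y : Fin k → ℝ) : Fin k → ℤ :=
  Classical.epsilon fun n : Fin k → ℤ =>
    intVec n + 𝒟.s ∈ 𝒟.strip ∧ 𝒟.proj (intVec n + 𝒟.s) = y

/-- The patch of shape `Ω` at `y`: `P(y,Ω) = {y' ∈ Y : ρ(ỹ' - ỹ) ∈ ρ(Ω)}`,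
where `Ω ⊆ ℝ^d` is viewed inside `⟨e₁,…,e_d⟩_ℝ ⊆ ℝ^k`. -/
def patch (Ω : Set (Fin d → ℝ)) (y : Fin k → ℝ) : Set (Fin k → ℝ) :=
  {y' | y' ∈ 𝒟.Y ∧
    𝒟.rho (intVec (𝒟.intRep y') - intVec (𝒟.intRep y)) ∈ 𝒟.rho '' (emb k d '' Ω)}

/-- Two patches of shape `Ω` are equivalent if they agree up to the translation
taking one distinguished point to the other. -/
def PatchEquiv (Ω : Set (Fin d → ℝ)) (y₁ y₂ : Fin k → ℝ) : Prop :=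
  𝒟.patch Ω y₁ = {z | ∃ w ∈ 𝒟.patch Ω y₂, z = w + (y₁ - y₂)}

/-- The pattern (equivalence class) of the patch of shape `Ω` at `y` occurs in the
region `R ⊆ E`: some point `y' ∈ Y ∩ R` has patch equivalent to that at `y`. -/
def OccursIn (Ω : Set (Fin d → ℝ)) (y : Fin k → ℝ) (R : Set (Fin k → ℝ)) : Prop :=
  ∃ y' ∈ 𝒟.Y ∩ R, 𝒟.PatchEquiv Ω y' y

/-- `Y` is linearly repetitive with respect to a collection `𝒜` of shapes in `ℝ^d`:
there is `C > 0` such that for every `Ω ∈ 𝒜`, every pattern of shape `Ω` occurring in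
`Y` occurs in every ball in `E` of volume `C·|Ω|` (balls in `E` being images under the
identification `ρ ∘ emb : ℝ^d ≅ E` of balls in `ℝ^d`). -/
def IsLR (𝒜 : Set (Set (Fin d → ℝ))) : Prop :=
  ∃ C > (0 : ℝ), ∀ Ω ∈ 𝒜, ∀ y ∈ 𝒟.Y, ∀ (x : Fin d → ℝ) (r : ℝ),
    volume (Metric.closedBall x r) = ENNReal.ofReal C * volume Ω →
    𝒟.OccursIn Ω y (𝒟.rho '' (emb k d '' Metric.closedBall x r))

/-- `Y` is `LR_Ω` with respect to a collection `𝒜` of shapes in `ℝ^d`: there is `C > 0`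
such that for every `Ω ∈ 𝒜`, every pattern of shape `Ω` occurring in `Y` occurs in every
translate of `C·Ω`. -/
def IsLROmega (𝒜 : Set (Set (Fin d → ℝ))) : Prop :=
  ∃ C > (0 : ℝ), ∀ Ω ∈ 𝒜, ∀ y ∈ 𝒟.Y, ∀ x : Fin d → ℝ,
    𝒟.OccursIn Ω y (𝒟.rho '' (emb k d '' {z | ∃ w ∈ Ω, z = x + C • w}))

end CPS

/-- `ℛ_d`: aligned rectangles in `ℝ^d` with integer vertices and nonempty interior. -/
def RdCollection (d : ℕ) : Set (Set (Fin d → ℝ)) :=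
  {Ω | ∃ a b : Fin d → ℤ, (∀ i, a i < b i) ∧
    Ω = {x : Fin d → ℝ | ∀ i, (a i : ℝ) ≤ x i ∧ x i ≤ (b i : ℝ)}}

/-- `𝒞_d`: convex polytopes in `ℝ^d` with vertices in `ℤ^d` and nonempty interior. -/
def CdCollection (d : ℕ) : Set (Set (Fin d → ℝ)) :=
  {Ω | (∃ V : Finset (Fin d → ℤ),
      Ω = convexHull ℝ ((fun n : Fin d → ℤ => intVec n) '' (V : Set (Fin d → ℤ)))) ∧
    (interior Ω).Nonempty}

namespace CPS

variable {k d : ℕ} (𝒟 : CPS k d)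

/-- `z ↦ z - ρ z` as a linear map. -/
def star : (Fin k → ℝ) →ₗ[ℝ] (Fin k → ℝ) := LinearMap.id - 𝒟.rho

lemma star_apply (x : Fin k → ℝ) (j : Fin k) : 𝒟.star x j = x j - 𝒟.rho x j := rfl

/-- slope -/
def slope (hk : d ≤ k) (j : Fin k) (i : Fin d) : ℝ := 𝒟.rho (Pi.single (Fin.castLE hk i) 1) j

/-- internal coordinate of an integer point -/
def g (n : Fin k → ℤ) : Fin k → ℝ := 𝒟.star (intVec n + 𝒟.s)

lemma rho_eq (x : Fin k → ℝ) (i : Fin k) (hi : (i : ℕ) < d) : 𝒟.rho x i = x i := by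
  have := 𝒟.rho_decomp x i hi
  linarith

/-- An element of `E` with vanishing first `d` coordinates is zero. -/
lemma eq_zero_of_mem (hk : d ≤ k) (x : Fin k → ℝ) (hx : x ∈ 𝒟.E)
    (h0 : ∀ i : Fin k, (i : ℕ) < d → x i = 0) : x = 0 := by
  let p : 𝒟.E →ₗ[ℝ] (Fin d → ℝ) :=
    (LinearMap.funLeft ℝ ℝ (Fin.castLE hk)) ∘ₗ 𝒟.E.subtype
  have hsurj : Function.Surjective p := by
    intro v
    refine ⟨⟨𝒟.rho (emb k d v), 𝒟.rho_mem _⟩, ?_⟩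
    ext i
    simp only [p, LinearMap.comp_apply, LinearMap.funLeft_apply, Submodule.subtype_apply]
    rw [𝒟.rho_eq _ _ (by simp)]
    simp [emb]
  have hinj : Function.Injective p :=
    (LinearMap.injective_iff_surjective_of_finrank_eq_finrank (by simp [𝒟.rank_E])).2 hsurj
  have : (⟨x, hx⟩ : 𝒟.E) = 0 := by
    apply hinj
    ext i
    simp only [p, LinearMap.comp_apply, LinearMap.funLeft_apply, Submodule.subtype_apply]
    rw [h0 _ (by simp)]
    simp
  simpa using congrArg Subtype.val this

lemma rho_id (hk : d ≤ k) (x : Fin k → ℝ) (hx : x ∈ 𝒟.E) : 𝒟.rho x = x := by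
  have := 𝒟.eq_zero_of_mem hk (x - 𝒟.rho x) (𝒟.E.sub_mem hx (𝒟.rho_mem x))
    (fun i hi => by simpa using 𝒟.rho_decomp x i hi)
  exact (sub_eq_zero.1 this).symm

lemma rho_zero (hk : d ≤ k) (x : Fin k → ℝ) (h0 : ∀ i : Fin k, (i : ℕ) < d → x i = 0) :
    𝒟.rho x = 0 :=
  𝒟.eq_zero_of_mem hk _ (𝒟.rho_mem x) (fun i hi => by rw [𝒟.rho_eq x i hi, h0 i hi])

lemma rho_congr (hk : d ≤ k) (x y : Fin k → ℝ) (h0 : ∀ i : Fin k, (i : ℕ) < d → x i = y i) :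
    𝒟.rho x = 𝒟.rho y := by
  have := 𝒟.rho_zero hk (x - y) (fun i hi => by simp [h0 i hi])
  rwa [map_sub, sub_eq_zero] at this

lemma rho_apply_sum (hk : d ≤ k) (x : Fin k → ℝ) (j : Fin k) :
    𝒟.rho x j = ∑ i : Fin d, x (Fin.castLE hk i) * 𝒟.slope hk j i := by
  have h1 : 𝒟.rho x = 𝒟.rho (∑ i : Fin d, x (Fin.castLE hk i) •
      (Pi.single (Fin.castLE hk i) 1 : Fin k → ℝ)) := by
    apply 𝒟.rho_congr hk
    intro i hi
    rw [Finset.sum_apply, Finset.sum_eq_single (⟨i, hi⟩ : Fin d)]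
    · simp
    · intro b _ hb
      have : i ≠ Fin.castLE hk b := by
        rintro rfl
        apply hb
        ext; simp
      simp [this]
    · simp
  rw [h1, map_sum, Finset.sum_apply]
  simp [slope]

lemma mem_strip_iff (hk : d ≤ k) (hc : 𝒟.IsCubical) (z : Fin k → ℝ) :
    z ∈ 𝒟.strip ↔ ∀ j : Fin k, d ≤ (j : ℕ) → 0 ≤ 𝒟.star z j ∧ 𝒟.star z j < 1 := by
  constructor
  · rintro ⟨w, hw, e, he, rfl⟩ j hj
    have h1 : 𝒟.star (w + e) = w := by
      have h2 := 𝒟.rho_zero hk w (𝒟.window_sub w hw)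
      have h3 := 𝒟.rho_id hk e he
      simp [star, h2, h3]
    rw [h1]
    rw [hc] at hw
    have := hw j
    rwa [if_neg (by omega)] at this
  · intro h
    refine ⟨𝒟.star z, ?_, 𝒟.rho z, 𝒟.rho_mem z, by simp [star]⟩
    rw [hc]
    intro i
    split_ifs with hi
    · simp [star_apply, 𝒟.rho_eq z i hi]
    · exact h i (by omega)

lemma intRep_eq (n : Fin k → ℤ) (hn : intVec n + 𝒟.s ∈ 𝒟.strip) :
    𝒟.intRep (𝒟.proj (intVec n + 𝒟.s)) = n := by
  have := Classical.epsilon_spec (p := fun m : Fin k → ℤ =>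
    intVec m + 𝒟.s ∈ 𝒟.strip ∧ 𝒟.proj (intVec m + 𝒟.s) = 𝒟.proj (intVec n + 𝒟.s)) ⟨n, hn, rfl⟩
  apply 𝒟.proj_inj
  have h2 : 𝒟.proj (intVec (𝒟.intRep (𝒟.proj (intVec n + 𝒟.s))) + 𝒟.s) =
    𝒟.proj (intVec n + 𝒟.s) := this.2
  generalize 𝒟.intRep (𝒟.proj (intVec n + 𝒟.s)) = m at h2 ⊢
  rw [map_add, map_add] at h2
  exact add_right_cancel h2

lemma mem_Y (n : Fin k → ℤ) (hn : intVec n + 𝒟.s ∈ 𝒟.strip) :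
    𝒟.proj (intVec n + 𝒟.s) ∈ 𝒟.Y := ⟨_, ⟨hn, n, rfl⟩, rfl⟩

lemma intVec_add (a b : Fin k → ℤ) : intVec (a + b) = intVec a + intVec b := by
  ext i; simp [intVec]

lemma patch_transfer (hk : d ≤ k) (Ω : Set (Fin d → ℝ)) (n n' v : Fin k → ℤ)
    (hn : intVec n + 𝒟.s ∈ 𝒟.strip)
    (hp : 𝒟.PatchEquiv Ω (𝒟.proj (intVec n' + 𝒟.s)) (𝒟.proj (intVec n + 𝒟.s)))
    (hv : intVec (n + v) + 𝒟.s ∈ 𝒟.strip)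
    (hΩ : (fun i : Fin d => (v (Fin.castLE hk i) : ℝ)) ∈ Ω) :
    intVec (n' + v) + 𝒟.s ∈ 𝒟.strip := by
  have h1 : 𝒟.proj (intVec (n + v) + 𝒟.s) ∈ 𝒟.patch Ω (𝒟.proj (intVec n + 𝒟.s)) := by
    refine ⟨𝒟.mem_Y _ hv, ?_⟩
    rw [𝒟.intRep_eq _ hv, 𝒟.intRep_eq _ hn]
    refine ⟨_, ⟨_, hΩ, rfl⟩, ?_⟩
    apply 𝒟.rho_congr hk
    intro i hi
    simp [emb, hi, intVec]
  have h2 : 𝒟.proj (intVec (n' + v) + 𝒟.s) ∈ 𝒟.patch Ω (𝒟.proj (intVec n' + 𝒟.s)) := by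
    rw [hp]
    refine ⟨_, h1, ?_⟩
    simp only [intVec_add, map_add]
    abel
  obtain ⟨⟨z, ⟨hz, m, rfl⟩, hm⟩, -⟩ := h2
  have h3 : m = n' + v := by
    apply 𝒟.proj_inj
    simp only [map_add, add_left_inj] at hm
    exact hm
  rwa [h3] at hz

lemma floor_transfer (hk : d ≤ k) (hc : 𝒟.IsCubical) (Ω : Set (Fin d → ℝ)) (n n' : Fin k → ℤ)
    (hn : intVec n + 𝒟.s ∈ 𝒟.strip)
    (hp : 𝒟.PatchEquiv Ω (𝒟.proj (intVec n' + 𝒟.s)) (𝒟.proj (intVec n + 𝒟.s)))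
    (i : Fin d) (t : ℤ) (hΩ : (Pi.single i (t : ℝ) : Fin d → ℝ) ∈ Ω) (j : Fin k)
    (hj : d ≤ (j : ℕ)) :
    ⌊𝒟.g n j - t * 𝒟.slope hk j i⌋ = ⌊𝒟.g n' j - t * 𝒟.slope hk j i⌋ := by
  let v : Fin k → ℤ := fun l => if (l : ℕ) < d then (if (l : ℕ) = i then t else 0)
    else - ⌊𝒟.g n l - t * 𝒟.slope hk l i⌋
  have hgv : ∀ (m : Fin k → ℤ) (l : Fin k), d ≤ (l : ℕ) → 𝒟.star (intVec (m + v) + 𝒟.s) l =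
      (𝒟.g m l - t * 𝒟.slope hk l i) - ⌊𝒟.g n l - t * 𝒟.slope hk l i⌋ := by
    intro m l hl
    have h1 : intVec (m + v) + 𝒟.s = (intVec m + 𝒟.s) + intVec v := by
      rw [intVec_add]; abel
    rw [h1, map_add, Pi.add_apply, 𝒟.star_apply (intVec v), 𝒟.rho_apply_sum hk (intVec v)]
    rw [Finset.sum_eq_single i]
    · have : ¬ ((l : ℕ) < d) := by omega
      simp only [intVec, v, this, if_false, g]
      simp
      ring
    · intro b _ hb
      have : (b : ℕ) ≠ i := fun h => hb (Fin.ext h)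
      simp [intVec, v, this]
    · simp
  have h2 := 𝒟.patch_transfer hk Ω n n' v hn hp (by
    rw [𝒟.mem_strip_iff hk hc]
    intro l hl
    rw [hgv n l hl]
    exact ⟨Int.fract_nonneg _, Int.fract_lt_one _⟩) (by
    convert hΩ using 1
    ext b
    by_cases hb : b = i
    · subst hb; simp [v]
    · have : (b : ℕ) ≠ i := fun h => hb (Fin.ext h)
      simp [v, this, hb])
  rw [𝒟.mem_strip_iff hk hc] at h2
  have h3 := h2 j hj
  rw [hgv n' j hj] at h3
  symm
  rw [Int.floor_eq_iff]
  constructor <;> linarith [h3.1, h3.2]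

lemma exists_near (hk : d ≤ k) (U : Fin k → Set ℝ) (hU : ∀ j, IsOpen (U j))
    (hne : ∀ j, (U j).Nonempty) :
    ∃ n : Fin k → ℤ, ∀ j : Fin k, d ≤ (j : ℕ) → 𝒟.g n j ∈ U j := by
  choose u hu using hne
  let V : Set (Fin k → ℝ) := {z | ∀ j : Fin k, d ≤ (j : ℕ) → 𝒟.star (z + 𝒟.s) j ∈ U j}
  have hcont : Continuous fun z => 𝒟.star (z + 𝒟.s) :=
    (LinearMap.continuous_of_finiteDimensional 𝒟.star).comp (continuous_id.add continuous_const)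
  have hV : IsOpen V := by
    have : V = ⋂ j : Fin k, ⋂ _ : d ≤ (j : ℕ), (fun z => 𝒟.star (z + 𝒟.s) j) ⁻¹' U j := by
      ext z; simp [V]
    rw [this]
    refine isOpen_iInter_of_finite fun j => isOpen_iInter_of_finite fun _ => ?_
    exact (hU j).preimage ((continuous_apply j).comp hcont)
  have hVne : V.Nonempty := by
    refine ⟨(fun j : Fin k => if (j : ℕ) < d then 0 else u j) - 𝒟.s, ?_⟩
    intro j hj
    rw [sub_add_cancel, 𝒟.star_apply, 𝒟.rho_zero hk]
    · have : ¬ ((j : ℕ) < d) := by omega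
      simpa [this] using hu j
    · intro i hi; simp [hi]
  obtain ⟨x, hxV, e, he, n, rfl⟩ := 𝒟.totallyIrrational.inter_open_nonempty V hV hVne
  refine ⟨n, fun j hj => ?_⟩
  have := hxV j hj
  have h0 : 𝒟.star e = 0 := by simp [star, 𝒟.rho_id hk e he]
  rw [add_assoc, map_add, h0, zero_add] at this
  exact this

lemma exists_irr (hk : d ≤ k) (j : Fin k) (hj : d ≤ (j : ℕ)) :
    ∃ i, Irrational (𝒟.slope hk j i) := by
  by_contra! hcon
  have hr : ∀ i, ∃ q : ℚ, (q : ℝ) = 𝒟.slope hk j i := by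
    intro i
    have := hcon i
    rw [Irrational, not_not] at this
    exact this
  choose q hq using hr
  let Q : ℕ := ∏ i, (q i).den
  have hQ : 0 < Q := Finset.prod_pos fun i _ => (q i).den_pos
  have hp : ∀ i, ∃ p : ℤ, (p : ℝ) = Q * 𝒟.slope hk j i := by
    intro i
    obtain ⟨c, hc⟩ : (q i).den ∣ Q := Finset.dvd_prod_of_mem _ (Finset.mem_univ i)
    refine ⟨c * (q i).num, ?_⟩
    rw [← hq i, hc]
    have h := Rat.mul_den_eq_num (q i)
    have h' : ((q i : ℚ) : ℝ) * ((q i).den : ℝ) = ((q i).num : ℝ) := by exact_mod_cast h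
    push_cast
    rw [← h']; ring
  choose p hp using hp
  have hclosed : IsClosed {z : Fin k → ℝ | (Q : ℝ) * 𝒟.star z j ∈ Set.range ((↑) : ℤ → ℝ)} := by
    have hcl : IsClosed (Set.range ((↑) : ℤ → ℝ)) := Int.isClosedEmbedding_coe_real.isClosed_range
    refine hcl.preimage ?_
    exact continuous_const.mul ((continuous_apply j).comp
      (LinearMap.continuous_of_finiteDimensional 𝒟.star))
  have hsub : {x : Fin k → ℝ | ∃ e ∈ 𝒟.E, ∃ n : Fin k → ℤ, x = e + intVec n} ⊆
      {z : Fin k → ℝ | (Q : ℝ) * 𝒟.star z j ∈ Set.range ((↑) : ℤ → ℝ)} := by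
    rintro x ⟨e, he, n, rfl⟩
    have h0 : 𝒟.star e = 0 := by simp [star, 𝒟.rho_id hk e he]
    refine ⟨Q * n j - ∑ i, n (Fin.castLE hk i) * p i, ?_⟩
    rw [map_add, h0, zero_add, 𝒟.star_apply, 𝒟.rho_apply_sum hk]
    push_cast
    rw [mul_sub, Finset.mul_sum]
    congr 1
    refine Finset.sum_congr rfl fun i _ => ?_
    rw [hp i]; simp only [intVec]; ring
  have hall := (𝒟.totallyIrrational.mono hsub).closure_eq
  rw [hclosed.closure_eq] at hall
  have hmem : (Pi.single j (1 / (2 * (Q : ℝ))) : Fin k → ℝ) ∈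
      {z : Fin k → ℝ | (Q : ℝ) * 𝒟.star z j ∈ Set.range ((↑) : ℤ → ℝ)} := by
    rw [hall]; trivial
  obtain ⟨a, ha⟩ := hmem
  rw [𝒟.star_apply, 𝒟.rho_zero hk] at ha
  · have hQ' : (Q : ℝ) ≠ 0 := by positivity
    have h2 : (2 * a : ℝ) = 1 := by
      rw [ha]; simp; field_simp
    have h3 : 2 * a = 1 := by exact_mod_cast h2
    omega
  · intro i hi
    have : i ≠ j := by rintro rfl; omega
    simp [this]

lemma g_eq (hk : d ≤ k) (hc : 𝒟.IsCubical) (n n' : Fin k → ℤ)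
    (hn : intVec n + 𝒟.s ∈ 𝒟.strip) (hn' : intVec n' + 𝒟.s ∈ 𝒟.strip) (j : Fin k)
    (hj : d ≤ (j : ℕ)) (i₂ : Fin d)
    (hne : ∀ i, i ≠ i₂ → n (Fin.castLE hk i) = n' (Fin.castLE hk i)) (p : ℤ)
    (hp : ((n (Fin.castLE hk i₂) : ℝ) - n' (Fin.castLE hk i₂)) * 𝒟.slope hk j i₂ = p) :
    𝒟.g n j = 𝒟.g n' j := by
  have h1 : 𝒟.g n j - 𝒟.g n' j = ((n j - n' j - p : ℤ) : ℝ) := by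
    rw [← Pi.sub_apply, g, g, ← map_sub, add_sub_add_right_eq_sub, 𝒟.star_apply,
      𝒟.rho_apply_sum hk, Finset.sum_eq_single i₂]
    · push_cast
      rw [← hp]; simp [intVec]
    · intro b _ hb
      simp [intVec, hne b hb]
    · simp
  have ha := (𝒟.mem_strip_iff hk hc _).1 hn j hj
  have hb := (𝒟.mem_strip_iff hk hc _).1 hn' j hj
  change 0 ≤ 𝒟.g n j ∧ 𝒟.g n j < 1 at ha
  change 0 ≤ 𝒟.g n' j ∧ 𝒟.g n' j < 1 at hb
  have h2 : ((n j - n' j - p : ℤ) : ℝ) < 1 := by linarith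
  have h3 : (-1 : ℝ) < ((n j - n' j - p : ℤ) : ℝ) := by linarith
  have h4 : n j - n' j - p = 0 := by
    have h2' : n j - n' j - p < 1 := by exact_mod_cast h2
    have h3' : -1 < n j - n' j - p := by exact_mod_cast h3
    omega
  rw [h4] at h1
  simp at h1
  linarith

/-- Separating labels for cells. -/
lemma exists_labels (a : ℝ) (ha : Irrational a) (N : ℕ) :
    ∃ U : ℕ → Set ℝ, (∀ t, IsOpen (U t)) ∧ (∀ t, (U t).Nonempty) ∧ (∀ t, U t ⊆ Set.Ioo 0 1) ∧
      ∀ t ≤ N, ∀ t' ≤ N, ∀ w ∈ U t, ∀ w' ∈ U t',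
        (∀ τ : ℕ, τ ≤ N → ⌊w - τ * a⌋ = ⌊w' - τ * a⌋) → t = t' := by
  let c : ℕ → ℝ := fun t => Int.fract (t * a)
  have hcinj : ∀ t t', c t = c t' → t = t' := by
    intro t t' h
    by_contra hne
    obtain ⟨z, hz⟩ := Int.fract_eq_fract.1 h
    have h0 : ((t : ℤ) - t' : ℤ) ≠ 0 := by
      intro h; apply hne; omega
    have := (ha.intCast_mul h0).ne_int z
    apply this
    rw [← hz]; push_cast; ring
  have key : ∀ t t', c t < c t' → ∀ w w', c t < w → w < c t' → c t' < w' → w' < 1 →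
      ⌊w - t' * a⌋ ≠ ⌊w' - t' * a⌋ := by
    intro t t' _ w w' h1 h2 h3 h4
    have hc0 : 0 ≤ c t := Int.fract_nonneg _
    have hc1 : c t' < 1 := Int.fract_lt_one _
    have hc2 : 0 ≤ c t' := Int.fract_nonneg _
    have e : (t' : ℝ) * a = ⌊(t' : ℝ) * a⌋ + c t' := (Int.floor_add_fract _).symm
    have e1 : ⌊w - t' * a⌋ = - ⌊(t' : ℝ) * a⌋ - 1 := by
      rw [Int.floor_eq_iff]; push_cast
      constructor <;> linarith
    have e2 : ⌊w' - t' * a⌋ = - ⌊(t' : ℝ) * a⌋ := by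
      rw [Int.floor_eq_iff]; push_cast
      constructor <;> linarith
    rw [e1, e2]; omega
  refine ⟨fun t => Set.Ioo (c t) 1 ∩ ⋂ t' ∈ Finset.range (N + 1), {w | c t < c t' → w < c t'},
    ?_, ?_, ?_, ?_⟩
  · intro t
    refine isOpen_Ioo.inter (isOpen_biInter_finset fun t' _ => ?_)
    by_cases h : c t < c t'
    · simp only [h, true_imp_iff]
      exact isOpen_Iio
    · simp [h]
  · intro t
    have h1 : ∀ᶠ w in nhdsWithin (c t) (Set.Ioi (c t)), w ∈ Set.Ioo (c t) 1 :=
      Ioo_mem_nhdsGT (Int.fract_lt_one _)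
    have h2 : ∀ᶠ w in nhdsWithin (c t) (Set.Ioi (c t)),
        ∀ t' ∈ Finset.range (N + 1), (c t < c t' → w < c t') := by
      rw [Filter.eventually_all_finset]
      intro t' _
      by_cases h : c t < c t'
      · filter_upwards [Ioo_mem_nhdsGT h] with w hw _ using hw.2
      · simp [h]
    obtain ⟨w, hw1, hw2⟩ := (h1.and h2).exists
    exact ⟨w, hw1, by simpa using hw2⟩
  · rintro t w ⟨hw, -⟩
    exact ⟨lt_of_le_of_lt (Int.fract_nonneg _) hw.1, hw.2⟩
  · rintro t ht t' ht' w ⟨hw, hw2⟩ w' ⟨hw', hw2'⟩ hall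
    simp only [Set.mem_iInter, Set.mem_ofPred_eq, Finset.mem_range] at hw2 hw2'
    apply hcinj
    rcases lt_trichotomy (c t) (c t') with h | h | h
    · exact absurd (hall t' ht') (key t t' h w w' hw.1 (hw2 t' (by omega) h) hw'.1 hw'.2)
    · exact h
    · exact absurd (hall t ht).symm
        (key t' t h w' w hw'.1 (hw2' t (by omega) h) hw.1 hw.2)

lemma exists_occ (hd : 1 ≤ d) (hk : d ≤ k) (hc : 𝒟.IsCubical) (hLR : 𝒟.IsLR (RdCollection d)) :
    ∃ D : ℕ, 1 ≤ D ∧ ∀ M : ℕ, 1 ≤ M → ∀ i : Fin d, ∀ n : Fin k → ℤ,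
      intVec n + 𝒟.s ∈ 𝒟.strip → ∃ n' : Fin k → ℤ, intVec n' + 𝒟.s ∈ 𝒟.strip ∧
        (∀ l : Fin d, |n' (Fin.castLE hk l)| ≤ (D : ℤ) * M) ∧
        ∀ j : Fin k, d ≤ (j : ℕ) → ∀ t : ℕ, t ≤ M ^ d →
          ⌊𝒟.g n j - t * 𝒟.slope hk j i⌋ = ⌊𝒟.g n' j - t * 𝒟.slope hk j i⌋ := by
  obtain ⟨C, hC, hLR⟩ := hLR
  let pc := LinearMap.toContinuousLinearMap 𝒟.proj
  let c : ℝ := C ^ (1 / (d : ℝ))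
  have hcpos : 0 < c := Real.rpow_pos_of_pos hC _
  have hcd : c ^ d = C := by
    simp only [c]
    rw [one_div, Real.rpow_inv_natCast_pow hC.le (by omega)]
  obtain ⟨D, hD⟩ := exists_nat_ge (c + ‖pc‖ + ‖𝒟.s‖ + 1)
  have hp0 : 0 ≤ ‖pc‖ := norm_nonneg _
  have hs0 : 0 ≤ ‖𝒟.s‖ := norm_nonneg _
  refine ⟨D, ?_, ?_⟩
  · have : (1 : ℝ) ≤ D := by linarith
    exact_mod_cast this
  intro M hM i n hn
  have hM1 : (1 : ℝ) ≤ M := by exact_mod_cast hM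
  let b : Fin d → ℤ := Function.update (fun _ => 1) i ((M : ℤ) ^ d)
  have hMd : (0 : ℤ) < (M : ℤ) ^ d := by positivity
  have hb : ∀ l, 0 < b l := by
    intro l
    by_cases h : l = i
    · subst h; simpa [b] using hMd
    · simp [b, h]
  let Ω : Set (Fin d → ℝ) := {x | ∀ l, (((0 : Fin d → ℤ) l : ℤ) : ℝ) ≤ x l ∧ x l ≤ (b l : ℝ)}
  have hΩ : Ω ∈ RdCollection d := ⟨0, b, by simpa using hb, rfl⟩
  have hvol : volume Ω = ENNReal.ofReal ((M : ℝ) ^ d) := by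
    have : Ω = Set.Icc (0 : Fin d → ℝ) (fun l => (b l : ℝ)) := by
      ext x; simp [Ω, Set.mem_Icc, Pi.le_def, forall_and]
    rw [this, Real.volume_Icc_pi, Finset.prod_eq_single i]
    · simp [b]
    · intro l _ hl; simp [b, hl]
    · simp
  have hball : volume (Metric.closedBall (0 : Fin d → ℝ) (c * M / 2)) =
      ENNReal.ofReal C * volume Ω := by
    rw [Real.volume_pi_closedBall _ (by positivity), hvol, ← ENNReal.ofReal_mul hC.le]
    congr 1
    rw [← hcd, ← mul_pow]
    simp
    congr 1; ring
  obtain ⟨y', ⟨hyY, hyR⟩, hpe⟩ := hLR Ω hΩ _ (𝒟.mem_Y n hn) 0 (c * M / 2) hball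
  obtain ⟨z, ⟨hz, n', rfl⟩, rfl⟩ := hyY
  refine ⟨n', hz, ?_, ?_⟩
  · intro l
    obtain ⟨_, ⟨v, hv, rfl⟩, hve⟩ := hyR
    have e1 : 𝒟.rho (emb k d v) (Fin.castLE hk l) = v l := by
      rw [𝒟.rho_eq _ _ (by simp)]; simp [emb]
    have e2 : 𝒟.proj (intVec n' + 𝒟.s) = 𝒟.rho (intVec n' + 𝒟.s) + 𝒟.proj (𝒟.g n') := by
      have : intVec n' + 𝒟.s = 𝒟.rho (intVec n' + 𝒟.s) + 𝒟.g n' := by simp [g, star]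
      conv_lhs => rw [this]
      rw [map_add, 𝒟.proj_id _ (𝒟.rho_mem _)]
    have e3 : v l = (n' (Fin.castLE hk l) : ℝ) + 𝒟.s (Fin.castLE hk l)
        + 𝒟.proj (𝒟.g n') (Fin.castLE hk l) := by
      rw [← e1, hve, e2, Pi.add_apply, 𝒟.rho_eq _ _ (by simp)]
      simp [intVec]
    have hgn : ‖𝒟.g n'‖ ≤ 1 := by
      rw [pi_norm_le_iff_of_nonneg zero_le_one]
      intro m
      by_cases hm : (m : ℕ) < d
      · simp [g, star_apply, 𝒟.rho_eq _ m hm]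
      · have := (𝒟.mem_strip_iff hk hc _).1 hz m (by omega)
        change 0 ≤ 𝒟.g n' m ∧ 𝒟.g n' m < 1 at this
        rw [Real.norm_eq_abs, abs_le]
        constructor <;> linarith [this.1, this.2]
    have b1 : |𝒟.proj (𝒟.g n') (Fin.castLE hk l)| ≤ ‖pc‖ := by
      calc _ ≤ ‖pc (𝒟.g n')‖ := norm_le_pi_norm (pc (𝒟.g n')) _
        _ ≤ ‖pc‖ * ‖𝒟.g n'‖ := pc.le_opNorm _
        _ ≤ ‖pc‖ := mul_le_of_le_one_right hp0 hgn
    have b2 : |𝒟.s (Fin.castLE hk l)| ≤ ‖𝒟.s‖ := norm_le_pi_norm 𝒟.s _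
    have b3 : |v l| ≤ c * M / 2 := by
      rw [mem_closedBall_zero_iff] at hv
      exact (norm_le_pi_norm v l).trans hv
    have b4 : (|n' (Fin.castLE hk l)| : ℝ) ≤ D * M := by
      have h5 : c * M / 2 + ‖pc‖ + ‖𝒟.s‖ ≤ D * M := by
        have : (c + ‖pc‖ + ‖𝒟.s‖ + 1) * M ≤ D * M :=
          mul_le_mul_of_nonneg_right hD (by positivity)
        nlinarith [mul_nonneg hp0 (sub_nonneg.2 hM1), mul_nonneg hs0 (sub_nonneg.2 hM1),
          mul_pos hcpos (lt_of_lt_of_le one_pos hM1)]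
      rw [abs_le] at b1 b2 b3 ⊢
      constructor <;> linarith [b1.1, b1.2, b2.1, b2.2, b3.1, b3.2]
    exact_mod_cast b4
  · intro j hj t ht
    refine 𝒟.floor_transfer hk hc Ω n n' hn hpe i t ?_ j hj
    intro l
    by_cases hl : l = i
    · subst hl
      simp only [Pi.single_eq_same, b, Function.update_self, Pi.zero_apply]
      push_cast
      exact ⟨by positivity, by exact_mod_cast ht⟩
    · simp [hl, b]

end CPS

/-- For all integers `k > d ≥ 1` with `k - d > 1`, there is no `k` to `d`
cubical cut and project set which is LR with respect to `ℛ_d`. -/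
theorem no_cubical_LR_wrt_Rd_of_codim_gt_one (k d : ℕ) (hd : 1 ≤ d) (hkd : d + 1 < k)
    (𝒟 : CPS k d) (h : 𝒟.IsCubicalCPSet) :
    ¬ 𝒟.IsLR (RdCollection d) := by
  classical
  intro hLR
  obtain ⟨hc, -, -⟩ := h
  have hk : d ≤ k := by omega
  obtain ⟨D, hD1, hocc⟩ := 𝒟.exists_occ hd hk hc hLR
  let j₁ : Fin k := ⟨d, by omega⟩
  let j₂ : Fin k := ⟨d + 1, by omega⟩
  have hj₁ : d ≤ (j₁ : ℕ) := le_refl d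
  have hj₂ : d ≤ (j₂ : ℕ) := Nat.le_succ d
  have hj12 : j₁ ≠ j₂ := by simp [j₁, j₂]
  obtain ⟨i₁, hi₁⟩ := 𝒟.exists_irr hk j₁ hj₁
  obtain ⟨i₂, hi₂⟩ := 𝒟.exists_irr hk j₂ hj₂
  have hstrip : ∀ n : Fin k → ℤ, (∀ j : Fin k, d ≤ (j : ℕ) → 𝒟.g n j ∈ Set.Ioo (0 : ℝ) 1) →
      intVec n + 𝒟.s ∈ 𝒟.strip := by
    intro n hn
    rw [𝒟.mem_strip_iff hk hc]
    exact fun j hj => ⟨(hn j hj).1.le, (hn j hj).2⟩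
  have hcard : ∀ M : ℕ, 1 ≤ M →
      (Finset.Icc (-((D : ℤ) * M)) ((D : ℤ) * M)).card ≤ 3 * D * M := by
    intro M hM
    rw [Int.card_Icc]
    have : 1 ≤ (D : ℤ) * M := by
      have : 1 ≤ D * M := Nat.mul_pos hD1 hM
      exact_mod_cast this
    zify
    rw [Int.toNat_of_nonneg (by linarith)]
    linarith
  by_cases hirr : Irrational (𝒟.slope hk j₁ i₂)
  · -- two irrational slopes in the same direction
    let M : ℕ := (3 * D) ^ d
    have hM : 1 ≤ M := Nat.pos_of_ne_zero (by positivity)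
    obtain ⟨U, hUo, hUn, hUs, hU⟩ := CPS.exists_labels _ hirr (M ^ d)
    obtain ⟨V, hVo, hVn, hVs, hV⟩ := CPS.exists_labels _ hi₂ (M ^ d)
    have hex : ∀ p : ℕ × ℕ, ∃ n : Fin k → ℤ, intVec n + 𝒟.s ∈ 𝒟.strip ∧
        𝒟.g n j₁ ∈ U p.1 ∧ 𝒟.g n j₂ ∈ V p.2 := by
      intro p
      let W : Fin k → Set ℝ := fun j => if j = j₁ then U p.1 else if j = j₂ then V p.2 else
        Set.Ioo 0 1
      obtain ⟨n, hn⟩ := 𝒟.exists_near hk W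
        (by intro j; simp only [W]; split_ifs; exacts [hUo _, hVo _, isOpen_Ioo])
        (by intro j; simp only [W]; split_ifs; exacts [hUn _, hVn _, ⟨1 / 2, by norm_num⟩])
      refine ⟨n, hstrip n fun j hj => ?_, ?_, ?_⟩
      · have := hn j hj
        simp only [W] at this
        split_ifs at this
        exacts [hUs _ this, hVs _ this, this]
      · simpa [W] using hn j₁ hj₁
      · simpa [W, hj12.symm] using hn j₂ hj₂
    choose n hn hnU hnV using hex
    choose n' hn' hbd hfl using fun p => hocc M hM i₂ (n p) (hn p)
    have hle := Finset.card_le_card_of_injOn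
      (s := Finset.range (M ^ d + 1) ×ˢ Finset.range (M ^ d + 1))
      (t := Fintype.piFinset fun _ : Fin d => Finset.Icc (-((D : ℤ) * M)) ((D : ℤ) * M))
      (fun p l => n' p (Fin.castLE hk l))
      (by
        intro p _
        simp only [Finset.mem_coe, Fintype.mem_piFinset, Finset.mem_Icc]
        exact fun l => abs_le.1 (hbd p l))
      (by
        intro p hp p' hp' heq
        simp only [Finset.coe_product, Set.mem_prod, Finset.mem_coe, Finset.mem_range] at hp hp'
        have hg : ∀ j : Fin k, d ≤ (j : ℕ) → 𝒟.g (n' p) j = 𝒟.g (n' p') j := by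
          intro j hj
          refine 𝒟.g_eq hk hc _ _ (hn' p) (hn' p') j hj i₂ (fun l _ => congrFun heq l) 0 ?_
          have := congrFun heq i₂
          simp only at this
          simp [this]
        ext
        · refine hU p.1 (by omega) p'.1 (by omega) _ (hnU p) _ (hnU p') fun τ hτ => ?_
          rw [hfl p j₁ hj₁ τ hτ, hfl p' j₁ hj₁ τ hτ, hg j₁ hj₁]
        · refine hV p.2 (by omega) p'.2 (by omega) _ (hnV p) _ (hnV p') fun τ hτ => ?_
          rw [hfl p j₂ hj₂ τ hτ, hfl p' j₂ hj₂ τ hτ, hg j₂ hj₂])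
    rw [Finset.card_product, Finset.card_range, Fintype.card_piFinset, Finset.prod_const,
      Finset.card_univ, Fintype.card_fin] at hle
    have h2 := hle.trans (Nat.pow_le_pow_left (hcard M hM) d)
    rw [mul_pow] at h2
    have h3 : M ≤ M ^ d := Nat.le_self_pow (by omega) M
    have h4 : (3 * D) ^ d * M ^ d ≤ M ^ d * M ^ d := Nat.mul_le_mul_right _ h3
    nlinarith
  · -- a rational slope
    rw [Irrational, not_not] at hirr
    obtain ⟨r, hr⟩ := hirr
    obtain ⟨M, hMdef⟩ : ∃ M : ℕ, M = r.den * (3 * D) ^ (d - 1) := ⟨_, rfl⟩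
    have hM : 1 ≤ M := hMdef ▸ Nat.mul_pos r.den_pos (by positivity)
    obtain ⟨U, hUo, hUn, hUs, hU⟩ := CPS.exists_labels _ hi₁ (M ^ d)
    have hex : ∀ p : ℕ, ∃ n : Fin k → ℤ, intVec n + 𝒟.s ∈ 𝒟.strip ∧ 𝒟.g n j₁ ∈ U p := by
      intro p
      obtain ⟨n, hn⟩ := 𝒟.exists_near hk (fun j => if j = j₁ then U p else Set.Ioo 0 1)
        (by intro j; split_ifs; exacts [hUo _, isOpen_Ioo])
        (by intro j; split_ifs; exacts [hUn _, ⟨1 / 2, by norm_num⟩])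
      refine ⟨n, hstrip n fun j hj => ?_, ?_⟩
      · have := hn j hj
        split_ifs at this
        exacts [hUs _ this, this]
      · simpa using hn j₁ hj₁
    choose n hn hnU using hex
    choose n' hn' hbd hfl using fun p => hocc M hM i₁ (n p) (hn p)
    have hden : (0 : ℤ) < r.den := by exact_mod_cast r.den_pos
    have hle := Finset.card_le_card_of_injOn
      (s := Finset.range (M ^ d + 1))
      (t := Fintype.piFinset fun l : Fin d => if l = i₂ then Finset.Ico (0 : ℤ) r.den else
        Finset.Icc (-((D : ℤ) * M)) ((D : ℤ) * M))
      (fun p l => if l = i₂ then n' p (Fin.castLE hk l) % r.den else n' p (Fin.castLE hk l))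
      (by
        intro p _
        simp only [Finset.mem_coe, Fintype.mem_piFinset]
        intro l
        split_ifs with hl
        · rw [Finset.mem_Ico]
          exact ⟨Int.emod_nonneg _ hden.ne', Int.emod_lt_of_pos _ hden⟩
        · rw [Finset.mem_Icc]
          exact abs_le.1 (hbd p l))
      (by
        intro p hp p' hp' heq
        simp only [Finset.mem_coe, Finset.mem_range] at hp hp'
        have hg : 𝒟.g (n' p) j₁ = 𝒟.g (n' p') j₁ := by
          have hmod := congrFun heq i₂
          simp only [if_true] at hmod
          obtain ⟨c, hcc⟩ := Int.ModEq.dvd (show (n' p' (Fin.castLE hk i₂)) ≡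
            (n' p (Fin.castLE hk i₂)) [ZMOD r.den] from hmod.symm)
          refine 𝒟.g_eq hk hc _ _ (hn' p) (hn' p') j₁ hj₁ i₂ (fun l hl => ?_) (c * r.num) ?_
          · have := congrFun heq l
            simpa only [hl, if_false] using this
          · have h' : ((r : ℚ) : ℝ) * (r.den : ℝ) = (r.num : ℝ) := by
              exact_mod_cast Rat.mul_den_eq_num r
            have h'' : ((n' p (Fin.castLE hk i₂) : ℝ) - n' p' (Fin.castLE hk i₂)) =
                r.den * c := by exact_mod_cast hcc
            rw [h'', ← hr]
            push_cast
            rw [← h']; ring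
        refine hU p (by omega) p' (by omega) _ (hnU p) _ (hnU p') fun τ hτ => ?_
        rw [hfl p j₁ hj₁ τ hτ, hfl p' j₁ hj₁ τ hτ, hg])
    rw [Finset.card_range, Fintype.card_piFinset,
      ← Finset.mul_prod_erase Finset.univ _ (Finset.mem_univ i₂)] at hle
    have h1 : ∏ x ∈ Finset.univ.erase i₂, (if x = i₂ then Finset.Ico (0 : ℤ) r.den else
        Finset.Icc (-((D : ℤ) * M)) ((D : ℤ) * M)).card ≤ (3 * D * M) ^ (d - 1) := by
      have := Finset.prod_le_pow_card (Finset.univ.erase i₂)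
        (fun x => (if x = i₂ then Finset.Ico (0 : ℤ) r.den else
          Finset.Icc (-((D : ℤ) * M)) ((D : ℤ) * M)).card) (3 * D * M)
        (by
          intro x hx
          simp only [Finset.ne_of_mem_erase hx, if_false]
          exact hcard M hM)
      simpa using this
    have h2 := hle.trans (Nat.mul_le_mul_left _ h1)
    simp only [if_true, Int.card_Ico, sub_zero, Int.toNat_natCast] at h2
    rw [mul_pow, ← mul_assoc, ← hMdef, mul_comm, ← pow_succ, Nat.sub_add_cancel hd] at h2
    omega
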